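/- arXiv:math/0102149 — 3 statements merged into one kernel-verified Lean document; each statement's English description precedes it below -/
import Mathlib

section
/- The subfield of ℂ generated over ℚ by all the entries of S and T equals the cyclotomic field ℚ(ζ_N), where ζ_N = exp(2πi/N) and N is the exact order of T. In particular, every entry of S lies in ℚ(ζ_N); that is, the conductor equals the order of the Dehn twist T. -/
open Matrix Complex

abbrev SL2Z := Matrix.SpecialLinearGroup (Fin 2) ℤ

def sM : SL2Z := ⟨!![0, -1; 1, 0], by norm_num [Matrix.det_fin_two_of]⟩
def tM : SL2Z := ⟨!![1, 1; 0, 1], by norm_num [Matrix.det_fin_two_of]⟩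

/-- A field is relatively algebraically closed in a purely transcendental extension of it. -/
theorem mem_range_algebraMap_of_isAlgebraic_of_mem_adjoin {F E ι : Type*} [Field F] [Field E]
    [Algebra F E] {b : ι → E} (hb : AlgebraicIndependent F b) {x : E} (hx : IsAlgebraic F x)
    (hxb : x ∈ IntermediateField.adjoin F (Set.range b)) : x ∈ Set.range (algebraMap F E) := by
  obtain ⟨r, s, hrs⟩ := (IntermediateField.mem_adjoin_range_iff F b x).1 hxb
  by_cases hs : s = 0
  · exact ⟨0, by simp [hrs, hs]⟩
  have hs' : MvPolynomial.aeval b s ≠ 0 := fun h =>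
    hs (hb (by simpa using h))
  let A := algebraicClosure F E
  let y : A := ⟨x, (mem_algebraicClosure_iff).2 hx⟩
  have hbA : AlgebraicIndependent A b := hb.algebraicClosure
  have key : MvPolynomial.C y * s.map (algebraMap F A) = r.map (algebraMap F A) := by
    apply hbA
    have hy : algebraMap A E y = x := rfl
    rw [map_mul, MvPolynomial.aeval_C, MvPolynomial.aeval_map_algebraMap,
      MvPolynomial.aeval_map_algebraMap, hy, hrs, div_mul_cancel₀ _ hs']
  obtain ⟨m, hm⟩ := MvPolynomial.ne_zero_iff.1 hs
  have hc := congrArg (MvPolynomial.coeff m) key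
  rw [MvPolynomial.coeff_C_mul, MvPolynomial.coeff_map, MvPolynomial.coeff_map] at hc
  have hcE : x * algebraMap F E (s.coeff m) = algebraMap F E (r.coeff m) :=
    congrArg (algebraMap A E) hc
  refine ⟨r.coeff m / s.coeff m, ?_⟩
  rw [map_div₀, ← hcE, mul_div_cancel_right₀]
  simpa using hm

/-- An algebraic element of an algebraically closed extension which is fixed by all
automorphisms of the extension lies in the base field, in characteristic zero. -/
theorem mem_range_algebraMap_of_forall_algEquiv {F E : Type*} [Field F] [CharZero F] [Field E]
    [Algebra F E] [IsAlgClosed E] {x : E} (hx : IsAlgebraic F x)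
    (hfix : ∀ σ : E ≃ₐ[F] E, σ x = x) : x ∈ Set.range (algebraMap F E) := by
  obtain ⟨ι, b, hb⟩ := exists_isTranscendenceBasis' F E
  let K := IntermediateField.adjoin F (Set.range b)
  have hK : Algebra.IsAlgebraic K E := hb.isAlgebraic_field
  have : IsAlgClosure K E := ⟨inferInstance, hK⟩
  have : IsGalois K E := { }
  refine mem_range_algebraMap_of_isAlgebraic_of_mem_adjoin hb.1 hx ?_
  obtain ⟨z, hz⟩ := (InfiniteGalois.mem_range_algebraMap_iff_fixed (k := K) x).2
    fun σ => hfix (σ.restrictScalars F)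
  exact hz ▸ z.2

theorem IntermediateField.mem_of_forall_algEquiv {k E : Type*} [Field k] [CharZero k] [Field E]
    [Algebra k E] [IsAlgClosed E] (L : IntermediateField k E) {x : E} (hx : IsAlgebraic k x)
    (hfix : ∀ σ : E ≃ₐ[L] E, σ x = x) : x ∈ L := by
  have : CharZero L := charZero_of_injective_algebraMap (algebraMap k L).injective
  obtain ⟨z, rfl⟩ := mem_range_algebraMap_of_forall_algEquiv (hx.tower_top L) hfix
  exact z.2

theorem tM_mul_sM_braid : tM * sM * tM * sM * tM = sM := by
  decide

namespace Matrix

variable {I R : Type*} [Fintype I]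

/-- If a ring endomorphism `f` fixes `T` entrywise, sends `S` to `S * G = G⁻¹ * S`, and `G`
commutes with `T`, then the relation `T S T S T = S` forces `f` to fix `S`. -/
theorem map_eq_self_of_braid [CommRing R] {S T G : Matrix I I R} (f : R →+* R)
    (hbraid : T * S * T * S * T = S) (hT : T.map f = T) (hSG : S.map f = S * G)
    (hGS : G * S.map f = S) (hcomm : T * G = G * T) : S.map f = S := by
  have h := congrArg (fun M => M.map f) hbraid
  simp only [Matrix.map_mul, hT] at h
  calc S.map f = T * S.map f * T * S.map f * T := h.symm
    _ = T * S * (G * T) * S.map f * T := by rw [hSG]; simp only [Matrix.mul_assoc]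
    _ = T * S * T * (G * S.map f) * T := by rw [← hcomm]; simp only [Matrix.mul_assoc]
    _ = S := by rw [hGS, hbraid]

variable [DecidableEq I]

theorem IsDiag.exists_eq_pow_of_pow_eq_one [CommRing R] [IsDomain R] {T : Matrix I I R}
    (hT : T.IsDiag) {N : ℕ} [NeZero N] (hTN : T ^ N = 1) {η : R} (hη : IsPrimitiveRoot η N)
    (p : I) : ∃ k : ℕ, T p p = η ^ k := by
  obtain ⟨d, rfl⟩ : ∃ d, T = diagonal d := ⟨_, hT.diagonal_diag.symm⟩
  rw [diagonal_pow, ← diagonal_one] at hTN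
  have h : d p ^ N = 1 := congrFun (diagonal_injective hTN) p
  obtain ⟨k, -, hk⟩ := hη.eq_pow_of_pow_eq_one h
  exact ⟨k, by simp [hk]⟩

/-- A ring endomorphism raising a primitive `N`-th root of unity to the power `l` raises a
diagonal matrix of order dividing `N` to the power `l`. -/
theorem IsDiag.map_eq_pow [CommRing R] [IsDomain R] {T : Matrix I I R}
    (hT : T.IsDiag) {N : ℕ} [NeZero N] (hTN : T ^ N = 1) {η : R} (hη : IsPrimitiveRoot η N)
    (f : R →+* R) {l : ℕ} (hf : f η = η ^ l) : T.map f = T ^ l := by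
  have h := hT.exists_eq_pow_of_pow_eq_one hTN hη
  obtain ⟨d, rfl⟩ : ∃ d, T = diagonal d := ⟨_, hT.diagonal_diag.symm⟩
  rw [diagonal_pow, diagonal_map (map_zero f)]
  congr 1
  ext p
  obtain ⟨k, hk⟩ := h p
  rw [diagonal_apply_eq] at hk
  simp only [Pi.pow_apply, hk, map_pow, hf, ← pow_mul, mul_comm]

end Matrix

theorem stmt3
    {I : Type} [Fintype I] [DecidableEq I] [Nonempty I] (i0 : I)
    (ρ : SL2Z →* (Matrix I I ℂ)ˣ)
    (S T : Matrix I I ℂ)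
    (hSdef : S = (↑(ρ sM) : Matrix I I ℂ)) (hTdef : T = (↑(ρ tM) : Matrix I I ℂ))
    (n N : ℕ) (hn : 0 < n) (hNpos : 0 < N) (hNdvd : N ∣ n)
    (hTdiag : T.IsDiag) (hTord : orderOf T = N)
    (hSsymm : S.IsSymm) (hSunit : Sᴴ * S = 1)
    (ζ : ℂ) (hζ : ζ = Complex.exp (2 * Real.pi * Complex.I / n))
    (hSfield : ∀ p q, S p q ∈ IntermediateField.adjoin ℚ {ζ})
    (perm : ℤ → Equiv.Perm I) (ε : ℤ → I → ℂ) (G : ℤ → Matrix I I ℂ)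
    (hε : ∀ l : ℤ, IsCoprime l (n : ℤ) → ∀ p, ε l p = 1 ∨ ε l p = -1)
    (hG : ∀ (l : ℤ) (p q : I), G l p q = ε l q * (if p = perm l q then 1 else 0))
    (hGal : ∀ l : ℤ, IsCoprime l (n : ℤ) → ∀ σ : ℂ →+* ℂ, σ ζ = ζ ^ l →
      S.map σ = S * G l ∧ G l * S.map σ = S)
    (hGT : ∀ l : ℤ, IsCoprime l (n : ℤ) → (G l)⁻¹ * T * G l = T ^ (l ^ 2 : ℤ))
    :
    IntermediateField.adjoin ℚ {x : ℂ | (∃ p q, S p q = x) ∨ (∃ p q, T p q = x)} =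
      IntermediateField.adjoin ℚ {Complex.exp (2 * Real.pi * Complex.I / N)} ∧
    ∀ p q, S p q ∈ IntermediateField.adjoin ℚ {Complex.exp (2 * Real.pi * Complex.I / N)} := by
  have : NeZero N := ⟨hNpos.ne'⟩
  have : NeZero n := ⟨hn.ne'⟩
  set η : ℂ := Complex.exp (2 * Real.pi * Complex.I / N) with hη_def
  have hη : IsPrimitiveRoot η N := Complex.isPrimitiveRoot_exp N hNpos.ne'
  have hζn : IsPrimitiveRoot ζ n := hζ ▸ Complex.isPrimitiveRoot_exp n hn.ne'
  have hTN : T ^ N = 1 := hTord ▸ pow_orderOf_eq_one T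
  have hbraid : T * S * T * S * T = S := by
    have h := congrArg (fun g => (↑(ρ g) : Matrix I I ℂ)) tM_mul_sM_braid
    simpa only [map_mul, Units.val_mul, ← hSdef, ← hTdef] using h
  have hηζ : η = ζ ^ (n / N) := by
    rw [hζ, ← Complex.exp_nat_mul, hη_def, Nat.cast_div hNdvd (by exact_mod_cast hNpos.ne')]
    have h1 : (n : ℂ) ≠ 0 := by exact_mod_cast hn.ne'
    have h2 : (N : ℂ) ≠ 0 := by exact_mod_cast hNpos.ne'
    congr 1
    field_simp
  have hroot : ∀ σ : ℂ →+* ℂ, ∃ l : ℕ, l.Coprime n ∧ σ ζ = ζ ^ l ∧ σ η = η ^ l := by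
    intro σ
    have h := hζn.map_of_injective σ.injective
    obtain ⟨l, -, hl, hσ⟩ := (hζn.isPrimitiveRoot_iff).1 h
    exact ⟨l, hl, hσ.symm, by rw [hηζ, map_pow, ← hσ, ← pow_mul, ← pow_mul, mul_comm]⟩
  have halgζ : IsAlgebraic ℚ ζ := (hζn.isIntegral hn).tower_top.isAlgebraic
  have halgη : IsAlgebraic ℚ η := (hη.isIntegral hNpos).tower_top.isAlgebraic
  have halgS : ∀ p q, IsAlgebraic ℚ (S p q) := fun p q => by
    have := IntermediateField.isAlgebraic_adjoin_simple halgζ.isIntegral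
    exact (IntermediateField.isAlgebraic_iff).1
      (Algebra.IsAlgebraic.isAlgebraic (⟨S p q, hSfield p q⟩ : IntermediateField.adjoin ℚ {ζ}))
  have hS : ∀ p q, S p q ∈ IntermediateField.adjoin ℚ {η} := fun p q => by
    refine IntermediateField.mem_of_forall_algEquiv _ (halgS p q) fun σ => ?_
    have hση : σ η = η :=
      σ.commutes ⟨η, IntermediateField.mem_adjoin_simple_self ℚ η⟩
    obtain ⟨l, hl, hlζ, hlη⟩ := hroot (σ : ℂ →+* ℂ)
    have hσT : T.map (σ : ℂ →+* ℂ) = T := by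
      simpa using hTdiag.map_eq_pow hTN hη (σ : ℂ →+* ℂ) (l := 1) (by simpa using hση)
    have hTl : T ^ l = T := by rw [← hTdiag.map_eq_pow hTN hη _ hlη, hσT]
    have hcop : IsCoprime (l : ℤ) (n : ℤ) := Nat.isCoprime_iff_coprime.2 hl
    obtain ⟨hSG, hGS⟩ := hGal l hcop (σ : ℂ →+* ℂ) (by simpa using hlζ)
    have hGunit : IsUnit (G l).det := by
      have hSdet : IsUnit S.det := by
        have h := congrArg Matrix.det hSunit
        rw [Matrix.det_mul, Matrix.det_one] at h
        exact IsUnit.of_mul_eq_one_right _ h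
      rw [← hGS, Matrix.det_mul] at hSdet
      exact isUnit_of_mul_isUnit_left hSdet
    have hcomm : T * G l = G l * T := by
      have h := hGT l hcop
      have hT2 : T ^ ((l : ℤ) ^ 2) = T := by
        rw [← Nat.cast_pow, zpow_natCast, pow_two, pow_mul, hTl, hTl]
      rw [hT2] at h
      calc T * G l = G l * ((G l)⁻¹ * T * G l) := by
            rw [Matrix.mul_assoc, Matrix.mul_nonsing_inv_cancel_left _ _ hGunit]
        _ = G l * T := by rw [h]
    have h := Matrix.map_eq_self_of_braid (σ : ℂ →+* ℂ) hbraid hσT hSG hGS hcomm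
    exact congrFun (congrFun h p) q
  refine ⟨le_antisymm (IntermediateField.adjoin_le_iff.2 ?_) ?_, hS⟩
  · rintro x (⟨p, q, rfl⟩ | ⟨p, q, rfl⟩)
    · exact hS p q
    · by_cases hpq : p = q
      · subst hpq
        obtain ⟨k, hk⟩ := hTdiag.exists_eq_pow_of_pow_eq_one hTN hη p
        exact hk ▸ pow_mem (IntermediateField.mem_adjoin_simple_self ℚ η) k
      · rw [hTdiag hpq]
        exact zero_mem _
  · rw [IntermediateField.adjoin_simple_le_iff]
    refine IntermediateField.mem_of_forall_algEquiv _ halgη fun σ => ?_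
    obtain ⟨l, -, -, hlη⟩ := hroot (σ : ℂ →+* ℂ)
    have hσT : T.map (σ : ℂ →+* ℂ) = T := by
      ext p q
      exact σ.commutes ⟨T p q, IntermediateField.subset_adjoin _ _ (Or.inr ⟨p, q, rfl⟩)⟩
    have hTl : T ^ l = T ^ 1 := by
      rw [← hTdiag.map_eq_pow hTN hη _ hlη, hσT, pow_one]
    have hTunit : IsUnit T := hTdef ▸ (ρ tM).isUnit
    have hmod : l ≡ 1 [MOD N] := by
      lift T to (Matrix I I ℂ)ˣ using hTunit
      rw [← hTord, orderOf_units]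
      exact pow_eq_pow_iff_modEq.1 (Units.ext (by simpa using hTl))
    calc σ η = η ^ l := hlη
      _ = η ^ 1 := by
        rw [hη.eq_orderOf] at hmod
        exact pow_eq_pow_of_modEq hmod (pow_orderOf_eq_one η)
      _ = η := pow_one η
end

section
/- If, for some integer l coprime to n, the permutation π_l is the identity permutation of I (equivalently, G_l is diagonal), then G_l is either the identity matrix or minus the identity matrix. -/
open Matrix Complex

/-- An injective ring homomorphism from a domain to an algebraically closed field extends along
any injective algebraic ring homomorphism into a domain. -/
theorem exists_ringHom_comp_eq_of_isAlgebraic {R S M : Type*} [CommRing R] [IsDomain R]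
    [CommRing S] [IsDomain S] [Field M] [IsAlgClosed M] (f : R →+* S) (g : R →+* M)
    (hf : Function.Injective f) (hg : Function.Injective g)
    (halg : ∀ x : S, ∃ p : Polynomial R, p ≠ 0 ∧ p.eval₂ f x = 0) :
    ∃ σ : S →+* M, σ.comp f = g := by
  let := f.toAlgebra
  let := g.toAlgebra
  have : FaithfulSMul R S := (faithfulSMul_iff_algebraMap_injective R S).2 hf
  have : FaithfulSMul R M := (faithfulSMul_iff_algebraMap_injective R M).2 hg
  have : Algebra.IsAlgebraic R S := ⟨halg⟩
  exact ⟨(IsAlgClosed.lift : S →ₐ[R] M).toRingHom, (IsAlgClosed.lift : S →ₐ[R] M).comp_algebraMap⟩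

/-- Every endomorphism of a subfield of an algebraically closed field extends to the whole field. -/
theorem IsAlgClosed.exists_ringHom_extending {E L : Type*} [Field E] [Field L] [Algebra E L]
    [IsAlgClosed L] (τ : E →+* E) :
    ∃ σ : L →+* L, ∀ x : E, σ (algebraMap E L x) = algebraMap E L (τ x) := by
  obtain ⟨s, hs⟩ := exists_isTranscendenceBasis E L
  have hinj : Function.Injective (MvPolynomial.aeval (R := E) ((↑) : s → L)) := hs.1
  obtain ⟨σ, hσ⟩ := exists_ringHom_comp_eq_of_isAlgebraic
    (MvPolynomial.aeval (R := E) ((↑) : s → L)).toRingHom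
    ((MvPolynomial.aeval (R := E) ((↑) : s → L)).toRingHom.comp (MvPolynomial.map τ))
    hinj (hinj.comp (MvPolynomial.map_injective τ τ.injective)) (fun x => by
      have := hs.isAlgebraic
      have hx := Algebra.IsAlgebraic.isAlgebraic (R := Algebra.adjoin E (Set.range ((↑) : s → L))) x
      obtain ⟨p, hp, hpx⟩ := hx
      refine ⟨p.map hs.1.aevalEquiv.symm.toRingEquiv.toRingHom, ?_, ?_⟩
      · exact (Polynomial.map_ne_zero_iff hs.1.aevalEquiv.symm.injective).2 hp
      · rw [Polynomial.eval₂_map, ← hpx, Polynomial.aeval_def]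
        congr 1
        ext y
        obtain ⟨z, rfl⟩ := hs.1.aevalEquiv.surjective y
        simp)
  refine ⟨σ, fun x => ?_⟩
  simpa using RingHom.congr_fun hσ (MvPolynomial.C x)

/-- Algebraically conjugate elements of an algebraically closed field are related by a ring
endomorphism. -/
theorem IsAlgClosed.exists_ringHom_apply_eq_of_minpoly_eq {F L : Type*} [Field F] [Field L]
    [Algebra F L] [IsAlgClosed L] {x y : L} (hx : IsAlgebraic F x)
    (h : minpoly F x = minpoly F y) : ∃ σ : L →+* L, σ x = y := by
  have hy : IsAlgebraic F y := by
    by_contra hy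
    exact minpoly.ne_zero hx.isIntegral
      (h.trans (minpoly.eq_zero fun hy' => hy hy'.isAlgebraic))
  let x' : algebraicClosure F L := ⟨x, mem_algebraicClosure_iff.2 hx⟩
  let y' : algebraicClosure F L := ⟨y, mem_algebraicClosure_iff.2 hy⟩
  have h' : minpoly F x' = minpoly F y' := by
    rw [← minpoly.algebraMap_eq (algebraMap (algebraicClosure F L) L).injective x',
      ← minpoly.algebraMap_eq (algebraMap (algebraicClosure F L) L).injective y']
    exact h
  have hroot : Polynomial.aeval y' (minpoly F x') = 0 := h' ▸ minpoly.aeval F y'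
  obtain ⟨τ, hτ⟩ := minpoly.exists_algEquiv_of_root
    (Algebra.IsAlgebraic.isAlgebraic (R := F) x') hroot
  obtain ⟨σ, hσ⟩ := IsAlgClosed.exists_ringHom_extending (L := L)
    (τ.symm : algebraicClosure F L →+* algebraicClosure F L)
  refine ⟨σ, (hσ x').trans ?_⟩
  exact congrArg (algebraMap (algebraicClosure F L) L) (τ.symm_apply_eq.2 hτ.symm)

/-- The Galois action `ζ ↦ ζ ^ l` on a primitive root of unity extends to `ℂ`. -/
theorem IsPrimitiveRoot.exists_ringHom_apply_eq_zpow {n : ℕ} (hn : 0 < n) {ζ : ℂ}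
    (hζ : IsPrimitiveRoot ζ n) {l : ℤ} (hl : IsCoprime l (n : ℤ)) :
    ∃ σ : ℂ →+* ℂ, σ ζ = ζ ^ l := by
  refine IsAlgClosed.exists_ringHom_apply_eq_of_minpoly_eq (F := ℚ)
    (hζ.isIntegral hn).tower_top.isAlgebraic ?_
  rw [← Polynomial.cyclotomic_eq_minpoly_rat hζ hn, ← Polynomial.cyclotomic_eq_minpoly_rat
    (hζ.zpow_of_gcd_eq_one l (Int.isCoprime_iff_gcd_eq_one.1 hl)) hn]

theorem stmt4
    {I : Type} [Fintype I] [DecidableEq I] [Nonempty I] (i0 : I)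
    (ρ : SL2Z →* (Matrix I I ℂ)ˣ)
    (S T : Matrix I I ℂ)
    (hSdef : S = (↑(ρ sM) : Matrix I I ℂ)) (hTdef : T = (↑(ρ tM) : Matrix I I ℂ))
    (n N : ℕ) (hn : 0 < n) (hNpos : 0 < N) (hNdvd : N ∣ n)
    (hTdiag : T.IsDiag) (hTord : orderOf T = N)
    (hSsymm : S.IsSymm) (hSunit : Sᴴ * S = 1)
    (ζ : ℂ) (hζ : ζ = Complex.exp (2 * Real.pi * Complex.I / n))
    (hSfield : ∀ p q, S p q ∈ IntermediateField.adjoin ℚ {ζ})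
    (perm : ℤ → Equiv.Perm I) (ε : ℤ → I → ℂ) (G : ℤ → Matrix I I ℂ)
    (hε : ∀ l : ℤ, IsCoprime l (n : ℤ) → ∀ p, ε l p = 1 ∨ ε l p = -1)
    (hG : ∀ (l : ℤ) (p q : I), G l p q = ε l q * (if p = perm l q then 1 else 0))
    (hGal : ∀ l : ℤ, IsCoprime l (n : ℤ) → ∀ σ : ℂ →+* ℂ, σ ζ = ζ ^ l →
      S.map σ = S * G l ∧ G l * S.map σ = S)
    (hSpos : ∀ p, ∃ r : ℝ, 0 < r ∧ S i0 p = (r : ℂ)) :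
    ∀ l : ℤ, IsCoprime l (n : ℤ) → perm l = 1 → G l = 1 ∨ G l = -1 := by
  intro l hl hperm
  obtain ⟨σ, hσ⟩ := IsPrimitiveRoot.exists_ringHom_apply_eq_zpow hn
    (hζ ▸ Complex.isPrimitiveRoot_exp n hn.ne') hl
  obtain ⟨h₁, h₂⟩ := hGal l hl σ hσ
  have hdiag : G l = Matrix.diagonal (ε l) := by
    ext p q
    by_cases h : p = q <;> simp [hG, hperm, h]
  have hsq : ∀ p, ε l p * ε l p = 1 := fun p => by
    rcases hε l hl p with h | h <;> simp [h]
  have hconst : ∀ q, ε l q = ε l i0 := by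
    intro q
    obtain ⟨r, hr, hS⟩ := hSpos q
    have e₁ := congrFun (congrFun h₁ i0) q
    have e₂ := congrFun (congrFun h₂ i0) q
    rw [hdiag, Matrix.mul_diagonal] at e₁
    rw [hdiag, Matrix.diagonal_mul, e₁, hS] at e₂
    have hr' : (r : ℂ) ≠ 0 := by exact_mod_cast hr.ne'
    have h : ε l i0 * ε l q = 1 := mul_left_cancel₀ hr' (by linear_combination e₂)
    linear_combination ε l i0 * h - ε l q * hsq i0
  have hε' : ε l = fun _ => ε l i0 := funext hconst
  rw [hdiag, hε']
  rcases hε l hl i0 with h | h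
  · exact Or.inl (by rw [h, Matrix.diagonal_one])
  · exact Or.inr (by rw [h, ← Matrix.diagonal_one, Matrix.diagonal_neg])
end

section
/- For every positive integer M, the principal congruence subgroup Γ(M) = { m ∈ SL(2,ℤ) : m ≡ 1 (mod M) } is contained in ker ρ if and only if N divides M. Hence ker ρ is a congruence subgroup whose level is exactly N, the order of the Dehn twist T. -/
open Matrix Complex

/-- A field `K` embeds over `R` into every algebraically closed extension of `R` containing as many
algebraically independent elements as a transcendence basis of `K`. -/
theorem IsTranscendenceBasis.nonempty_algHom_of_isAlgClosed {R K L ι : Type*} [Field R] [Field K]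
    [Field L] [IsAlgClosed L] [Algebra R K] [Algebra R L] {v : ι → K} {w : ι → L}
    (hv : IsTranscendenceBasis R v) (hw : AlgebraicIndependent R w) : Nonempty (K →ₐ[R] L) := by
  let A := Algebra.adjoin R (Set.range v)
  let φ : A →ₐ[R] L := (MvPolynomial.aeval w).comp hv.1.aevalEquiv.symm.toAlgHom
  have hφ : Function.Injective φ :=
    Function.Injective.comp (g := MvPolynomial.aeval w) hw hv.1.aevalEquiv.symm.injective
  let : Algebra A L := φ.toRingHom.toAlgebra
  have : IsScalarTower R A L := .of_algHom φ
  have : FaithfulSMul A L := (faithfulSMul_iff_algebraMap_injective A L).2 hφ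
  have : Algebra.IsAlgebraic A K := hv.isAlgebraic
  exact ⟨(IsAlgClosed.lift : K →ₐ[A] L).restrictScalars R⟩

theorem Complex.exists_isTranscendenceBasis_of_countable (R : Type) [Field R] [Countable R]
    [Algebra R ℂ] : ∃ v : ℂ → ℂ, IsTranscendenceBasis R v := by
  obtain ⟨s, hs⟩ := exists_isTranscendenceBasis R ℂ
  obtain ⟨e⟩ := Cardinal.eq.1 <|
    IsAlgClosed.cardinal_eq_cardinal_transcendence_basis_of_aleph0_lt' _ hs
      (Cardinal.mk_le_aleph0 (α := R)) (by simpa using Cardinal.aleph0_lt_continuum)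
  exact ⟨_, (isTranscendenceBasis_equiv e).2 hs⟩

/-- Any two embeddings of a countable field into `ℂ` differ by an endomorphism of `ℂ`. -/
theorem Complex.exists_ringHom_comp_eq {R : Type} [Field R] [Countable R] (f g : R →+* ℂ) :
    ∃ σ : ℂ →+* ℂ, σ.comp f = g := by
  obtain ⟨v, hv⟩ := @Complex.exists_isTranscendenceBasis_of_countable R _ _ f.toAlgebra
  obtain ⟨w, hw⟩ := @Complex.exists_isTranscendenceBasis_of_countable R _ _ g.toAlgebra
  obtain ⟨σ⟩ := @IsTranscendenceBasis.nonempty_algHom_of_isAlgClosed R ℂ ℂ ℂ _ _ _ _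
    f.toAlgebra g.toAlgebra v w hv hw.left
  exact ⟨@AlgHom.toRingHom _ _ _ _ _ _ f.toAlgebra g.toAlgebra σ,
    RingHom.ext (@AlgHom.commutes' _ _ _ _ _ _ f.toAlgebra g.toAlgebra σ)⟩

theorem Complex.exists_ringHom_map_eq_zpow {n : ℕ} (hn : 0 < n) {ζ : ℂ} (hζ : IsPrimitiveRoot ζ n)
    {d : ℤ} (hd : IsCoprime d (n : ℤ)) : ∃ σ : ℂ →+* ℂ, σ ζ = ζ ^ d := by
  have hint : IsIntegral ℚ ζ := (hζ.isIntegral hn).tower_top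
  have hζd := hζ.zpow_of_gcd_eq_one d (Int.isCoprime_iff_gcd_eq_one.1 hd)
  have hroot : ζ ^ d ∈ (minpoly ℚ ζ).aroots ℂ := by
    rw [Polynomial.mem_aroots, ← Polynomial.cyclotomic_eq_minpoly_rat hζ hn,
      Polynomial.cyclotomic_eq_minpoly_rat hζd hn]
    exact ⟨minpoly.ne_zero ((hζd.isIntegral hn).tower_top), minpoly.aeval ℚ _⟩
  let g := (IntermediateField.algHomAdjoinIntegralEquiv ℚ hint).symm ⟨ζ ^ d, hroot⟩
  have : Algebra.IsAlgebraic ℚ (IntermediateField.adjoin ℚ {ζ}) :=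
    IntermediateField.isAlgebraic_adjoin_simple hint
  have : Countable (IntermediateField.adjoin ℚ {ζ}) := Cardinal.mk_le_aleph0_iff.1 <|
    (Algebra.IsAlgebraic.cardinalMk_le_max ℚ _).trans (by simp)
  obtain ⟨σ, hσ⟩ :=
    Complex.exists_ringHom_comp_eq (algebraMap (IntermediateField.adjoin ℚ {ζ}) ℂ) g.toRingHom
  exact ⟨σ, (RingHom.congr_fun hσ (IntermediateField.AdjoinSimple.gen ℚ ζ)).trans
    (IntermediateField.algHomAdjoinIntegralEquiv_symm_apply_gen ℚ hint _)⟩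

theorem RingHom.apply_eq_self_of_mem_adjoin_rat {K : Type*} [Field K] [Algebra ℚ K] (σ : K →+* K)
    {ξ : K} (hξ : σ ξ = ξ) {x : K} (hx : x ∈ IntermediateField.adjoin ℚ {ξ}) : σ x = x := by
  induction hx using IntermediateField.adjoin_induction with
  | mem y hy => rwa [Set.mem_singleton_iff.1 hy]
  | algebraMap q => exact RingHom.map_rat_algebraMap σ q
  | add y z _ _ hy hz => rw [map_add, hy, hz]
  | inv y _ hy => rw [map_inv₀, hy]
  | mul y z _ _ hy hz => rw [map_mul, hy, hz]

theorem Int.exists_isCoprime_add_mul {n : ℕ} (hn : 0 < n) {d x : ℤ} (h : IsCoprime d x) :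
    ∃ j : ℤ, IsCoprime (d + x * j) (n : ℤ) := by
  rcases eq_or_ne x 0 with rfl | hx
  · refine ⟨0, ?_⟩
    rw [zero_mul, add_zero]
    exact isCoprime_one_left.of_isCoprime_of_dvd_left (isCoprime_zero_right.1 h).dvd
  have : NeZero (n * x.natAbs) := ⟨mul_ne_zero hn.ne' (Int.natAbs_ne_zero.2 hx)⟩
  have hd : IsUnit (d : ZMod x.natAbs) := by
    rw [ZMod.coe_int_isUnit_iff_isCoprime, Int.natCast_natAbs, IsCoprime.abs_left_iff]
    exact h.symm
  obtain ⟨u, hu⟩ := ZMod.unitsMap_surjective (Dvd.intro_left n rfl : x.natAbs ∣ n * x.natAbs)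
    hd.unit
  have hval : (((u : ZMod (n * x.natAbs)).val : ℤ) : ZMod x.natAbs) = d := by
    have := congrArg Units.val hu
    rw [ZMod.unitsMap_val, IsUnit.unit_spec, ZMod.cast_eq_val] at this
    exact_mod_cast this
  have hdvd : x ∣ (u : ZMod (n * x.natAbs)).val - d := by
    rw [← Int.natAbs_dvd, ← ZMod.intCast_eq_intCast_iff_dvd_sub, hval]
  obtain ⟨j, hj⟩ := hdvd
  refine ⟨j, ?_⟩
  rw [← hj, add_sub_cancel, Nat.isCoprime_iff_coprime]
  exact (ZMod.val_coe_unit_coprime u).coprime_mul_right_right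

theorem coe_tM_zpow (k : ℤ) : ((tM ^ k : SL2Z) : Matrix (Fin 2) (Fin 2) ℤ) = !![1, k; 0, 1] :=
  ModularGroup.coe_T_zpow k

theorem stmt14
    {I : Type} [Fintype I] [DecidableEq I] [Nonempty I] (i0 : I)
    (ρ : SL2Z →* (Matrix I I ℂ)ˣ)
    (S T : Matrix I I ℂ)
    (hSdef : S = (↑(ρ sM) : Matrix I I ℂ)) (hTdef : T = (↑(ρ tM) : Matrix I I ℂ))
    (n N : ℕ) (hn : 0 < n) (hNpos : 0 < N) (hNdvd : N ∣ n)
    (hTdiag : T.IsDiag) (hTord : orderOf T = N)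
    (hSsymm : S.IsSymm) (hSunit : Sᴴ * S = 1)
    (ζ : ℂ) (hζ : ζ = Complex.exp (2 * Real.pi * Complex.I / n))
    (hSfield : ∀ p q, S p q ∈ IntermediateField.adjoin ℚ {ζ})
    (perm : ℤ → Equiv.Perm I) (ε : ℤ → I → ℂ) (G : ℤ → Matrix I I ℂ)
    (hε : ∀ l : ℤ, IsCoprime l (n : ℤ) → ∀ p, ε l p = 1 ∨ ε l p = -1)
    (hG : ∀ (l : ℤ) (p q : I), G l p q = ε l q * (if p = perm l q then 1 else 0))
    (hGal : ∀ l : ℤ, IsCoprime l (n : ℤ) → ∀ σ : ℂ →+* ℂ, σ ζ = ζ ^ l →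
      S.map σ = S * G l ∧ G l * S.map σ = S)
    (hFor : ∀ (a b cc d : ℤ) (hdet : a * d - b * cc = 1), IsCoprime d (n : ℤ) →
      ∀ σ : ℂ →+* ℂ, σ ζ = ζ ^ d →
        ((↑(ρ ⟨!![a, b; cc, d], by rw [Matrix.det_fin_two_of]; linarith⟩) : Matrix I I ℂ)).map σ =
          T ^ b * S⁻¹ * T ^ (-cc) * S.map σ)
    (ζN : ℂ) (hζN : ζN = Complex.exp (2 * Real.pi * Complex.I / N))
    (hSN : ∀ p q, S p q ∈ IntermediateField.adjoin ℚ {ζN})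
    :
    ∀ M : ℕ, 0 < M → (CongruenceSubgroup.Gamma M ≤ MonoidHom.ker ρ ↔ N ∣ M) := by
  intro M _
  have hTk (k : ℤ) : ((ρ (tM ^ k) : (Matrix I I ℂ)ˣ) : Matrix I I ℂ) = T ^ k := by
    rw [map_zpow, Matrix.coe_units_zpow, hTdef]
  have hTone {k : ℤ} (hk : (N : ℤ) ∣ k) : T ^ k = 1 := by
    obtain ⟨j, rfl⟩ := hk
    have hN : ρ (tM ^ (N : ℤ)) = 1 :=
      Units.ext (by rw [hTk, zpow_natCast, ← hTord, pow_orderOf_eq_one, Units.val_one])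
    rw [← hTk, _root_.zpow_mul, map_zpow, hN, _root_.one_zpow, Units.val_one]
  have hSinv : S⁻¹ * S = 1 := by
    rw [Matrix.inv_eq_left_inv hSunit, hSunit]
  constructor
  · intro h
    have hmem : tM ^ (M : ℤ) ∈ CongruenceSubgroup.Gamma M := by
      rw [CongruenceSubgroup.Gamma_mem, coe_tM_zpow]
      simp
    have hker : T ^ (M : ℤ) = 1 := by rw [← hTk, MonoidHom.mem_ker.1 (h hmem), Units.val_one]
    rw [← hTord]
    exact orderOf_dvd_of_pow_eq_one (by rwa [zpow_natCast] at hker)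
  have hζprim : IsPrimitiveRoot ζ n := hζ ▸ Complex.isPrimitiveRoot_exp n hn.ne'
  have hζNprim : IsPrimitiveRoot ζN N := hζN ▸ Complex.isPrimitiveRoot_exp N hNpos.ne'
  have hζNpow : ζN = ζ ^ (n / N) := by
    obtain ⟨k, rfl⟩ := hNdvd
    rw [hζ, hζN, ← Complex.exp_nat_mul, Nat.mul_div_cancel_left k hNpos]
    have hN0 : (N : ℂ) ≠ 0 := Nat.cast_ne_zero.2 hNpos.ne'
    have hk0 : (k : ℂ) ≠ 0 := Nat.cast_ne_zero.2 (by rintro rfl; simp at hn)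
    congr 1
    push_cast
    field_simp
  have hcop (m : SL2Z) (hb : (N : ℤ) ∣ m 0 1) (hc : (N : ℤ) ∣ m 1 0) (hd : (N : ℤ) ∣ m 1 1 - 1)
      (hdn : IsCoprime (m 1 1) (n : ℤ)) : ρ m = 1 := by
    obtain ⟨σ, hσ⟩ := Complex.exists_ringHom_map_eq_zpow hn hζprim hdn
    have hσN : σ ζN = ζN := by
      have hN0 := hζNprim.ne_zero hNpos.ne'
      have hpow : ζN ^ (m 1 1 - 1) = 1 := (hζNprim.zpow_eq_one_iff_dvd _).2 hd
      rw [zpow_sub_one₀ hN0, mul_inv_eq_one₀ hN0] at hpow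
      conv_rhs => rw [← hpow, hζNpow, ← zpow_natCast, zpow_comm]
      rw [hζNpow, map_pow, hσ, zpow_natCast]
    have hσS : S.map σ = S := by
      ext p q
      exact σ.apply_eq_self_of_mem_adjoin_rat hσN (hSN p q)
    have hdet := m.det_coe
    rw [Matrix.det_fin_two] at hdet
    have hFm := hFor (m 0 0) (m 0 1) (m 1 0) (m 1 1) hdet hdn σ hσ
    have hm : (⟨!![m 0 0, m 0 1; m 1 0, m 1 1], by rw [Matrix.det_fin_two_of]; linarith⟩ : SL2Z)
        = m := Subtype.ext (Matrix.eta_fin_two _).symm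
    rw [hm, hσS, hTone hb, hTone ((dvd_neg).2 hc), one_mul, mul_one, hSinv] at hFm
    refine Units.ext (Matrix.map_injective σ.injective ?_)
    beta_reduce
    rw [hFm, Units.val_one, Matrix.map_one _ (map_zero σ) (map_one σ)]
  intro hNM m hm
  rw [CongruenceSubgroup.Gamma_mem] at hm
  obtain ⟨-, hb, hc, hd⟩ := hm
  have hNM' : (N : ℤ) ∣ M := Int.natCast_dvd_natCast.2 hNM
  have hb : (N : ℤ) ∣ m 0 1 := hNM'.trans ((ZMod.intCast_zmod_eq_zero_iff_dvd _ _).1 hb)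
  have hc : (N : ℤ) ∣ m 1 0 := hNM'.trans ((ZMod.intCast_zmod_eq_zero_iff_dvd _ _).1 hc)
  have hd : (N : ℤ) ∣ m 1 1 - 1 := hNM'.trans
    ((ZMod.intCast_eq_intCast_iff_dvd_sub _ _ _).1 (by simpa using hd.symm))
  have hdN : IsCoprime (m 1 1) (N : ℤ) := by
    obtain ⟨k, hk⟩ := hd
    exact ⟨1, -k, by linarith⟩
  have hdc : IsCoprime (m 1 1) (m 1 0) := by
    have hdet := m.det_coe
    rw [Matrix.det_fin_two] at hdet
    exact ⟨m 0 0, -m 0 1, by linarith⟩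
  obtain ⟨j, hj⟩ := Int.exists_isCoprime_add_mul hn (hdc.mul_right hdN)
  have hmul (i : Fin 2) : (m * tM ^ (N * j : ℤ)) i 0 = m i 0 ∧
      (m * tM ^ (N * j : ℤ)) i 1 = m i 1 + m i 0 * N * j := by
    rw [Matrix.SpecialLinearGroup.coe_mul, coe_tM_zpow]
    simp [Matrix.mul_apply, Fin.sum_univ_two]
    ring
  have key : ρ (m * tM ^ (N * j : ℤ)) = 1 := by
    apply hcop
    · rw [(hmul 0).2]
      exact dvd_add hb ⟨m 0 0 * j, by ring⟩
    · rwa [(hmul 1).1]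
    · rw [(hmul 1).2, add_sub_right_comm]
      exact dvd_add hd ⟨m 1 0 * j, by ring⟩
    · rwa [(hmul 1).2]
  have hTj : ρ (tM ^ (N * j : ℤ)) = 1 :=
    Units.ext (by rw [hTk, hTone (Dvd.intro _ rfl), Units.val_one])
  rw [MonoidHom.mem_ker, ← key, map_mul, hTj, mul_one]
end
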